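/- For every integer n ≥ 1, the braid group B_{n+1} is the group of fractions of the submonoid Σ_n generated by σ_1, σ_1 σ_2, …, σ_1 σ_2 ⋯ σ_n: every element g of B_{n+1} can be written g = a^{−1} b with a, b ∈ Σ_n; in particular Σ_n generates B_{n+1} as a group. -/

import Mathlib

/-- The defining relators of the braid group `B_{n+1}` on `n+1` strands: the generator
`k : Fin n` represents `σ_{k+1}`, and the relations are
`σ_i σ_{i+1} σ_i = σ_{i+1} σ_i σ_{i+1}` for `1 ≤ i < n` and `σ_i σ_j = σ_j σ_i` for
`|i - j| > 1`. -/
def BraidRels (n : ℕ) : Set (FreeGroup (Fin n)) :=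
  { r | (∃ (i : ℕ) (h1 : 1 ≤ i) (h2 : i < n),
          r = FreeGroup.of ⟨i - 1, by omega⟩ * FreeGroup.of ⟨i + 1 - 1, by omega⟩ *
                FreeGroup.of ⟨i - 1, by omega⟩ *
              (FreeGroup.of ⟨i + 1 - 1, by omega⟩ * FreeGroup.of ⟨i - 1, by omega⟩ *
                FreeGroup.of ⟨i + 1 - 1, by omega⟩)⁻¹) ∨
        (∃ (i j : ℕ) (hi1 : 1 ≤ i) (hi2 : i ≤ n) (hj1 : 1 ≤ j) (hj2 : j ≤ n),
          (i + 1 < j ∨ j + 1 < i) ∧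
          r = FreeGroup.of ⟨i - 1, by omega⟩ * FreeGroup.of ⟨j - 1, by omega⟩ *
              (FreeGroup.of ⟨j - 1, by omega⟩ * FreeGroup.of ⟨i - 1, by omega⟩)⁻¹) }

/-- The braid group on `n+1` strands, as a presented group. -/
abbrev Braid (n : ℕ) := PresentedGroup (BraidRels n)

/-- The Artin generator `σ_k` of the braid group `B_{n+1}`, for `1 ≤ k ≤ n`
(junk value `1` out of range). -/
def sigmaB (n : ℕ) (k : ℕ) : Braid n :=
  if h : 1 ≤ k ∧ k ≤ n then PresentedGroup.of ⟨k - 1, by omega⟩ else 1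

/-- The product `σ_1 σ_2 ⋯ σ_i` in the braid group `B_{n+1}`. -/
def Sprod (n : ℕ) (i : ℕ) : Braid n :=
  ((List.range i).map (fun t => sigmaB n (t + 1))).prod

/-- The submonoid `Σ_n` of the braid group `B_{n+1}` generated by
`σ_1, σ_1 σ_2, …, σ_1 σ_2 ⋯ σ_n`. -/
def SigmaN (n : ℕ) : Submonoid (Braid n) :=
  Submonoid.closure {x | ∃ i : ℕ, 1 ≤ i ∧ i ≤ n ∧ x = Sprod n i}

theorem sigB_braid (n i : ℕ) (h1 : 1 ≤ i) (h2 : i < n) :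
    sigmaB n i * sigmaB n (i+1) * sigmaB n i = sigmaB n (i+1) * sigmaB n i * sigmaB n (i+1) := by
  rw [sigmaB, sigmaB, dif_pos ⟨h1, by omega⟩, dif_pos ⟨by omega, by omega⟩]
  rw [← mul_inv_eq_one]
  exact PresentedGroup.one_of_mem (rels := BraidRels n) (Or.inl ⟨i, h1, h2, rfl⟩)

theorem sigB_comm (n i j : ℕ) (h : i + 1 < j) :
    sigmaB n i * sigmaB n j = sigmaB n j * sigmaB n i := by
  by_cases hi : 1 ≤ i ∧ i ≤ n
  · by_cases hj : 1 ≤ j ∧ j ≤ n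
    · rw [sigmaB, sigmaB, dif_pos hi, dif_pos hj]
      rw [← mul_inv_eq_one]
      exact PresentedGroup.one_of_mem (rels := BraidRels n)
        (Or.inr ⟨i, j, hi.1, hi.2, hj.1, hj.2, Or.inl h, rfl⟩)
    · have : sigmaB n j = 1 := dif_neg hj
      simp [this]
  · have : sigmaB n i = 1 := dif_neg hi
    simp [this]

theorem Sprod_zero' (n : ℕ) : Sprod n 0 = 1 := by simp [Sprod]

theorem Sprod_succ' (n i : ℕ) : Sprod n (i+1) = Sprod n i * sigmaB n (i+1) := by
  simp [Sprod, List.range_succ]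

theorem Sprod_comm (n p j : ℕ) (h : p + 1 < j) :
    Sprod n p * sigmaB n j = sigmaB n j * Sprod n p := by
  induction p with
  | zero => simp [Sprod_zero']
  | succ p ih =>
    rw [Sprod_succ', mul_assoc, sigB_comm n (p+1) j h, ← mul_assoc, ih (by omega), mul_assoc]

theorem Sprod_shift (n m k : ℕ) (hk : 1 ≤ k) (hkm : k < m) (hm : m ≤ n) :
    Sprod n m * sigmaB n k = sigmaB n (k+1) * Sprod n m := by
  induction m with
  | zero => omega
  | succ m ih =>
    rcases Nat.lt_or_ge k m with h | h
    · rw [Sprod_succ', mul_assoc, ← sigB_comm n k (m+1) (by omega), ← mul_assoc,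
        ih h (by omega), mul_assoc]
    · obtain rfl : k = m := by omega
      obtain ⟨p, rfl⟩ : ∃ p, k = p + 1 := ⟨k - 1, by omega⟩
      have hb := sigB_braid n (p+1) hk (by omega)
      calc Sprod n (p+1+1) * sigmaB n (p+1)
          = Sprod n p * (sigmaB n (p+1) * sigmaB n (p+1+1) * sigmaB n (p+1)) := by
            simp only [Sprod_succ', mul_assoc]
        _ = Sprod n p * sigmaB n (p+1+1) * (sigmaB n (p+1) * sigmaB n (p+1+1)) := by
            rw [hb]; simp only [mul_assoc]
        _ = _ := by
            rw [Sprod_comm n p (p+1+1) (by omega)]; simp only [Sprod_succ', mul_assoc]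

theorem Sprod_two (n m j : ℕ) (hj : j ≤ m) (hm : m + 1 ≤ n) :
    sigmaB n 1 * Sprod n (m+1) * Sprod n j = Sprod n (j+1) * Sprod n (m+1) := by
  induction j with
  | zero => simp [Sprod_zero', Sprod_succ' n 0]
  | succ j ih =>
    rw [Sprod_succ' n j, ← mul_assoc, ih (by omega), mul_assoc,
      Sprod_shift n (m+1) (j+1) (by omega) (by omega) hm, Sprod_succ' n (j+1), mul_assoc]

/-- Garside element `s_m s_{m-1} ⋯ s_1`. -/
def garD (n : ℕ) : ℕ → Braid n
  | 0 => 1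
  | m + 1 => Sprod n (m+1) * garD n m

theorem garD_comm (n p j : ℕ) (h : p + 1 < j) :
    garD n p * sigmaB n j = sigmaB n j * garD n p := by
  induction p with
  | zero => simp [garD]
  | succ p ih =>
    rw [garD, mul_assoc, ih (by omega), ← mul_assoc, Sprod_comm n (p+1) j h, mul_assoc]

theorem garD_flip (n m i : ℕ) (hi : 1 ≤ i) (him : i ≤ m) (hm : m ≤ n) :
    garD n m * sigmaB n i = sigmaB n (m + 1 - i) * garD n m := by
  induction m with
  | zero => omega
  | succ m ih =>
    rcases Nat.lt_or_ge m i with h | h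
    · obtain rfl : i = m + 1 := by omega
      have e : m + 1 + 1 - (m + 1) = 1 := by omega
      rw [e]
      cases m with
      | zero => simp [garD, Sprod_succ', Sprod_zero']
      | succ p =>
        have h2 := Sprod_two n (p+1) (p+1) le_rfl hm
        calc garD n (p+1+1) * sigmaB n (p+1+1)
            = Sprod n (p+1+1) * Sprod n (p+1) * (garD n p * sigmaB n (p+1+1)) := by
              simp only [garD, mul_assoc]
          _ = Sprod n (p+1+1) * (Sprod n (p+1) * sigmaB n (p+1+1)) * garD n p := by
              rw [garD_comm n p _ (by omega)]; simp only [mul_assoc]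
          _ = _ := by
              rw [← Sprod_succ' n (p+1), ← h2]; simp only [garD, mul_assoc]
    · have e : m + 1 + 1 - i = m + 1 - i + 1 := by omega
      rw [garD, mul_assoc, ih h (by omega), ← mul_assoc,
        Sprod_shift n (m+1) (m+1-i) (by omega) (by omega) hm, e, mul_assoc]

theorem braid_ind (n : ℕ) (H : Subgroup (Braid n))
    (h : ∀ i, 1 ≤ i → i ≤ n → sigmaB n i ∈ H) (g : Braid n) : g ∈ H := by
  have hc : Subgroup.closure (Set.range (PresentedGroup.of (rels := BraidRels n))) ≤ H := by
    rw [Subgroup.closure_le]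
    rintro _ ⟨⟨k, hk⟩, rfl⟩
    have := h (k+1) (by omega) (by omega)
    rw [sigmaB, dif_pos ⟨by omega, by omega⟩] at this
    exact this
  rw [PresentedGroup.closure_range_of] at hc
  exact hc trivial

theorem garD_sq_central (n : ℕ) (g : Braid n) :
    Commute (garD n n * garD n n) g := by
  have := braid_ind n (Subgroup.centralizer {garD n n * garD n n}) (by
    intro i h1 h2
    rw [Subgroup.mem_centralizer_singleton_iff]
    have e : n + 1 - (n + 1 - i) = i := by omega
    have := garD_flip n n (n+1-i) (by omega) (by omega) le_rfl
    rw [e] at this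
    rw [← mul_assoc, ← this, mul_assoc, mul_assoc, garD_flip n n i h1 h2 le_rfl]) g
  rw [Subgroup.mem_centralizer_singleton_iff] at this
  exact this.symm

theorem Sprod_mem (n i : ℕ) (hi : i ≤ n) : Sprod n i ∈ SigmaN n := by
  cases i with
  | zero => rw [Sprod_zero']; exact one_mem _
  | succ i => exact Submonoid.subset_closure ⟨i+1, by omega, hi, rfl⟩

theorem garD_mem (n m : ℕ) (hm : m ≤ n) : garD n m ∈ SigmaN n := by
  induction m with
  | zero => exact one_mem _
  | succ m ih => exact mul_mem (Sprod_mem n _ hm) (ih (by omega))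

theorem garD_split (n m i : ℕ) (hi : 1 ≤ i) (him : i ≤ m) (hm : m ≤ n) :
    ∃ P ∈ SigmaN n, ∃ Q ∈ SigmaN n, garD n m = P * Sprod n i * Q := by
  induction m with
  | zero => omega
  | succ m ih =>
    rcases Nat.lt_or_ge m i with h | h
    · obtain rfl : i = m + 1 := by omega
      exact ⟨1, one_mem _, garD n m, garD_mem n m (by omega), by simp [garD]⟩
    · obtain ⟨P, hP, Q, hQ, e⟩ := ih h (by omega)
      exact ⟨Sprod n (m+1) * P, mul_mem (Sprod_mem n _ hm) hP, Q, hQ, by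
        rw [garD, e]; simp only [mul_assoc]⟩

/-- Elements that enter `Σ_n` after multiplication by a power of the full twist. -/
def fracM (n : ℕ) : Submonoid (Braid n) where
  carrier := {g | ∃ k : ℕ, (garD n n * garD n n) ^ k * g ∈ SigmaN n}
  one_mem' := ⟨0, by simp⟩
  mul_mem' := by
    rintro a b ⟨k, hk⟩ ⟨l, hl⟩
    refine ⟨k + l, ?_⟩
    have c : (garD n n * garD n n) ^ l * a = a * (garD n n * garD n n) ^ l :=
      (garD_sq_central n a).pow_left l
    have e : (garD n n * garD n n) ^ (k + l) * (a * b)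
        = ((garD n n * garD n n) ^ k * a) * ((garD n n * garD n n) ^ l * b) := by
      rw [pow_add, mul_assoc, ← mul_assoc _ a b, c]; simp only [mul_assoc]
    rw [e]
    exact mul_mem hk hl

theorem SigmaN_le_fracM (n : ℕ) {g : Braid n} (h : g ∈ SigmaN n) : g ∈ fracM n :=
  ⟨0, by simpa using h⟩

theorem Sprod_inv_mem (n i : ℕ) (hi : i ≤ n) : (Sprod n i)⁻¹ ∈ fracM n := by
  rcases Nat.eq_zero_or_pos i with rfl | h
  · rw [Sprod_zero', inv_one]; exact one_mem _
  · obtain ⟨P, hP, Q, hQ, e⟩ := garD_split n n i h hi le_rfl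
    refine ⟨1, ?_⟩
    have c : garD n n * garD n n * (Sprod n i)⁻¹ = Q * garD n n * P := by
      have h1 := (garD_sq_central n (P * Sprod n i)).eq
      have h2 : garD n n * garD n n = P * Sprod n i * (Q * garD n n) := by
        rw [← mul_assoc, ← e]
      have h3 : garD n n * garD n n = Q * garD n n * (P * Sprod n i) := by
        apply mul_left_cancel (a := P * Sprod n i)
        rw [← h1, ← mul_assoc (P * Sprod n i), ← h2]
      rw [h3]; group
    rw [pow_one, c]
    exact mul_mem (mul_mem hQ (garD_mem n n le_rfl)) hP

theorem fracM_all (n : ℕ) (g : Braid n) : g ∈ fracM n := by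
  let H : Subgroup (Braid n) :=
    { carrier := {g | g ∈ fracM n ∧ g⁻¹ ∈ fracM n}
      one_mem' := ⟨one_mem _, by rw [inv_one]; exact one_mem _⟩
      mul_mem' := by
        rintro a b ⟨h1, h2⟩ ⟨h3, h4⟩
        exact ⟨mul_mem h1 h3, by rw [mul_inv_rev]; exact mul_mem h4 h2⟩
      inv_mem' := by
        rintro a ⟨h1, h2⟩
        exact ⟨h2, by rw [inv_inv]; exact h1⟩ }
  have hS : ∀ i, i ≤ n → Sprod n i ∈ H := fun i hi =>
    ⟨SigmaN_le_fracM n (Sprod_mem n i hi), Sprod_inv_mem n i hi⟩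
  have := braid_ind n H (by
    intro i h1 h2
    obtain ⟨p, rfl⟩ : ∃ p, i = p + 1 := ⟨i - 1, by omega⟩
    have e : sigmaB n (p+1) = (Sprod n p)⁻¹ * Sprod n (p+1) := by
      rw [Sprod_succ']; group
    rw [e]
    exact H.mul_mem (H.inv_mem (hS p (by omega))) (hS _ h2)) g
  exact this.1

/-- The braid group `B_{n+1}` is the group of fractions of `Σ_n`: every element of `B_{n+1}`
can be written as `a⁻¹ * b` with `a, b ∈ Σ_n`; in particular `Σ_n` generates `B_{n+1}` as a
group. -/
theorem stmt18 (n : ℕ) (hn : 1 ≤ n) :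
    (∀ g : Braid n, ∃ a b : Braid n, a ∈ SigmaN n ∧ b ∈ SigmaN n ∧ g = a⁻¹ * b) ∧
    Subgroup.closure (SigmaN n : Set (Braid n)) = ⊤ := by
  have key : ∀ g : Braid n, ∃ a b : Braid n, a ∈ SigmaN n ∧ b ∈ SigmaN n ∧ g = a⁻¹ * b := by
    intro g
    obtain ⟨k, hk⟩ := fracM_all n g
    have hD := garD_mem n n le_rfl
    exact ⟨_, _, pow_mem (mul_mem hD hD) k, hk, by group⟩
  refine ⟨key, ?_⟩
  rw [eq_top_iff]
  intro g _
  obtain ⟨a, b, ha, hb, rfl⟩ := key g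
  exact mul_mem (inv_mem (Subgroup.subset_closure ha)) (Subgroup.subset_closure hb)
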